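/- (Abstract form of Theorem 3.1: error estimate for the localized multiscale Galerkin method.) Assume a is in addition symmetric. Let K be a closed subspace of V with ‖ι k‖_H ≤ ε·‖k‖_V for all k ∈ K, let W = { v ∈ V : a(v,k) = 0 for all k ∈ K }, and let u ∈ V satisfy a(u, v) = ⟨f, ι v⟩_H for all v ∈ V. Let W_l be a closed subspace of V (the localized multiscale space) such that for every w ∈ W there exists w_l ∈ W_l with ‖w − w_l‖_V ≤ δ·‖w‖_V, for some constant δ ≥ 0, and let u_l ∈ W_l satisfy a(u_l, w) = ⟨f, ι w⟩_H for all w ∈ W_l. Then ‖u − u_l‖_V ≤ (β/α²)·(ε + C_e·δ)·‖f‖_H. -/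

import Mathlib

open RealInnerProductSpace

section CoerciveForms

variable {V : Type*} [NormedAddCommGroup V] [InnerProductSpace ℝ V]

/-- Lax–Milgram on a complete subspace: every vector has a Galerkin projection onto it. -/
theorem exists_galerkin_projection (a : V →ₗ[ℝ] V →ₗ[ℝ] ℝ) {α β : ℝ} (hα : 0 < α)
    (hbound : ∀ u v : V, |a u v| ≤ β * ‖u‖ * ‖v‖) (hcoer : ∀ v : V, α * ‖v‖ ^ 2 ≤ a v v)
    (K : Submodule ℝ V) [CompleteSpace K] (u : V) :
    ∃ k ∈ K, ∀ v ∈ K, a (u - k) v = 0 := by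
  let B : K →L[ℝ] K →L[ℝ] ℝ :=
    (a.domRestrict₁₂ K K).mkContinuous₂ β fun x y => hbound x y
  have hB : IsCoercive B := ⟨α, hα, fun v => by
    have h := hcoer v
    rw [sq, ← mul_assoc] at h
    exact h⟩
  let L : K →L[ℝ] ℝ := ((a u).domRestrict K).mkContinuous (β * ‖u‖) fun y => hbound u y
  let z := (InnerProductSpace.toDual ℝ K).symm L
  refine ⟨hB.continuousLinearEquivOfBilin.symm z, Submodule.coe_mem _, fun v hv => ?_⟩
  have h := hB.continuousLinearEquivOfBilin_apply
    (hB.continuousLinearEquivOfBilin.symm z) ⟨v, hv⟩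
  rw [ContinuousLinearEquiv.apply_symm_apply, InnerProductSpace.toDual_symm_apply] at h
  have h' : a u v = a (hB.continuousLinearEquivOfBilin.symm z : K) v := h
  rw [map_sub, LinearMap.sub_apply, h', sub_self]

/-- The energy estimate for a coercive form. -/
theorem norm_le_div_of_coercive (a : V →ₗ[ℝ] V →ₗ[ℝ] ℝ) {α c : ℝ} (hα : 0 < α)
    (hcoer : ∀ v : V, α * ‖v‖ ^ 2 ≤ a v v) (hc : 0 ≤ c) {v : V} (h : a v v ≤ c * ‖v‖) :
    ‖v‖ ≤ c / α := by
  rcases (norm_nonneg v).eq_or_lt with h0 | h0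
  · rw [← h0]
    positivity
  · rw [le_div_iff₀ hα]
    refine le_of_mul_le_mul_right ?_ h0
    linarith [hcoer v, show ‖v‖ * α * ‖v‖ = α * ‖v‖ ^ 2 by ring]

/-- Céa's lemma. -/
theorem norm_sub_le_of_galerkin_orthogonal (a : V →ₗ[ℝ] V →ₗ[ℝ] ℝ) {α β : ℝ} (hα : 0 < α)
    (hβ : 0 ≤ β) (hbound : ∀ u v : V, |a u v| ≤ β * ‖u‖ * ‖v‖)
    (hcoer : ∀ v : V, α * ‖v‖ ^ 2 ≤ a v v) {S : Submodule ℝ V} {u s w : V} (hs : s ∈ S)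
    (horth : ∀ v ∈ S, a (u - s) v = 0) (hw : w ∈ S) :
    ‖u - s‖ ≤ β * ‖u - w‖ / α := by
  refine norm_le_div_of_coercive a hα hcoer (by positivity) ?_
  have h : a (u - s) (u - s) = a (u - s) (u - w) := by
    rw [← sub_add_sub_cancel u w s, map_add (a _) (u - w), sub_add_sub_cancel,
      horth _ (S.sub_mem hw hs), add_zero]
  rw [h]
  linarith [le_abs_self (a (u - s) (u - w)), hbound (u - s) (u - w),
    mul_right_comm β ‖u - s‖ ‖u - w‖]

end CoerciveForms

/-- Abstract form of Theorem 3.1: error estimate for the localized multiscale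
Galerkin method. If every element of the ideal multiscale space
`W = {v | a v k = 0 for all k ∈ K}` can be approximated in `W_l` with relative
accuracy `δ`, then `‖u - u_l‖ ≤ (β/α²) * (ε + C_e * δ) * ‖f‖`. -/
theorem localized_multiscale_error
    {V H : Type*} [NormedAddCommGroup V] [InnerProductSpace ℝ V] [CompleteSpace V]
    [NormedAddCommGroup H] [InnerProductSpace ℝ H] [CompleteSpace H]
    (a : V →ₗ[ℝ] V →ₗ[ℝ] ℝ) (α β : ℝ) (hα : 0 < α) (hβ : 0 < β)
    (hbound : ∀ u v : V, |a u v| ≤ β * ‖u‖ * ‖v‖)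
    (hcoer : ∀ v : V, α * ‖v‖ ^ 2 ≤ a v v)
    (hsymm : ∀ u v : V, a u v = a v u)
    (ι : V →L[ℝ] H) (Ce : ℝ) (hCe : 0 < Ce) (hι : ∀ v : V, ‖ι v‖ ≤ Ce * ‖v‖)
    (f : H)
    (K : Submodule ℝ V) (hKc : IsClosed (K : Set V))
    (ε : ℝ) (hε : 0 < ε) (hK : ∀ k ∈ K, ‖ι k‖ ≤ ε * ‖k‖)
    (u : V) (hu : ∀ v : V, a u v = ⟪f, ι v⟫)
    (Wl : Submodule ℝ V) (hWlc : IsClosed (Wl : Set V))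
    (δ : ℝ) (hδ : 0 ≤ δ)
    (happrox : ∀ w : V, (∀ k ∈ K, a w k = 0) → ∃ wl ∈ Wl, ‖w - wl‖ ≤ δ * ‖w‖)
    (ul : V) (hulmem : ul ∈ Wl) (hul : ∀ w ∈ Wl, a ul w = ⟪f, ι w⟫) :
    ‖u - ul‖ ≤ (β / α ^ 2) * (ε + Ce * δ) * ‖f‖ := by
  have : CompleteSpace K := hKc.completeSpace_coe
  obtain ⟨k, hk, horth⟩ := exists_galerkin_projection a hα hbound hcoer K u
  obtain ⟨wl, hwl, hdist⟩ := happrox (u - k) horth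
  have hload : ∀ (v : V) (c : ℝ), ‖ι v‖ ≤ c * ‖v‖ → a u v ≤ c * ‖f‖ * ‖v‖ := fun v c hv => by
    rw [hu]
    calc ⟪f, ι v⟫ ≤ ‖f‖ * ‖ι v‖ := real_inner_le_norm _ _
      _ ≤ ‖f‖ * (c * ‖v‖) := by gcongr
      _ = c * ‖f‖ * ‖v‖ := by ring
  have hnk : ‖k‖ ≤ ε * ‖f‖ / α := by
    refine norm_le_div_of_coercive a hα hcoer (by positivity) ?_
    have h := horth k hk
    rw [map_sub, LinearMap.sub_apply, sub_eq_zero] at h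
    exact h ▸ hload k ε (hK k hk)
  have hnw : ‖u - k‖ ≤ Ce * ‖f‖ / α := by
    refine norm_le_div_of_coercive a hα hcoer (by positivity) ?_
    have h : a (u - k) (u - k) = a u (u - k) := by
      rw [map_sub a, LinearMap.sub_apply, hsymm k, horth k hk, sub_zero]
    exact h ▸ hload (u - k) Ce (hι _)
  have hcea : ‖u - ul‖ ≤ β * ‖u - wl‖ / α :=
    norm_sub_le_of_galerkin_orthogonal a hα hβ.le hbound hcoer hulmem
      (fun v hv => by rw [map_sub, LinearMap.sub_apply, hu, hul v hv, sub_self]) hwl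
  have hsplit : ‖u - wl‖ ≤ ‖k‖ + ‖u - k - wl‖ := by
    have h := norm_add_le k (u - k - wl)
    rwa [show k + (u - k - wl) = u - wl by abel] at h
  calc ‖u - ul‖ ≤ β * ‖u - wl‖ / α := hcea
    _ ≤ β * (ε * ‖f‖ / α + δ * (Ce * ‖f‖ / α)) / α := by
      gcongr
      exact hsplit.trans (add_le_add hnk (hdist.trans (by gcongr)))
    _ = (β / α ^ 2) * (ε + Ce * δ) * ‖f‖ := by
      field_simp
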